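/- arXiv:2307.06591 — 2 statements merged into one kernel-verified Lean document; each statement's English description precedes it below -/
import Mathlib

section
/- Let u be a d×d real totally nonnegative upper triangular unipotent matrix, let 1 ≤ k ≤ d, and suppose that every non-trivial ℓ×ℓ minor of u is positive for all ℓ < k. Fix a strictly increasing tuple I : Fin k → Fin d. If every non-trivial k×k minor of u of the form det(u.submatrix I J) with J consecutive is positive, then every non-trivial k×k minor of u of the form det(u.submatrix I J) is positive. -/
open Matrix

/-- An upper triangular unipotent `d × d` real matrix: all entries below the
diagonal vanish and all diagonal entries equal `1`. -/
def UTUnipotent {d : ℕ} (u : Matrix (Fin d) (Fin d) ℝ) : Prop :=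
  (∀ i j : Fin d, (j : ℕ) < (i : ℕ) → u i j = 0) ∧ ∀ i : Fin d, u i i = 1

/-- A (square, upper triangular unipotent) matrix is totally positive if all of
its non-trivial minors are positive: for all strictly increasing index tuples
`I J : Fin k → Fin d` with `I p ≤ J p` for all `p`, the corresponding minor is
positive. -/
def TotallyPositive {d : ℕ} (u : Matrix (Fin d) (Fin d) ℝ) : Prop :=
  ∀ k : ℕ, 1 ≤ k → k ≤ d → ∀ I J : Fin k → Fin d,
    StrictMono I → StrictMono J → (∀ p, I p ≤ J p) → 0 < (u.submatrix I J).det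

/-- A (square, upper triangular unipotent) matrix is totally nonnegative if all
of its non-trivial minors are nonnegative. -/
def TotallyNonneg {d : ℕ} (u : Matrix (Fin d) (Fin d) ℝ) : Prop :=
  ∀ k : ℕ, 1 ≤ k → k ≤ d → ∀ I J : Fin k → Fin d,
    StrictMono I → StrictMono J → (∀ p, I p ≤ J p) → 0 ≤ (u.submatrix I J).det

/-- The `d`-th upper triangular Pascal matrix: its `(i,j)` entry (`0`-indexed)
is `C(j,i)` when `i ≤ j` and `0` otherwise. -/
def pascal (d : ℕ) : Matrix (Fin d) (Fin d) ℝ :=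
  Matrix.of fun i j => if (i : ℕ) ≤ (j : ℕ) then ((j : ℕ).choose (i : ℕ) : ℝ) else 0

/-- A tuple `I : Fin k → Fin d` is consecutive if `I p = I 0 + p` for all `p`
(stated symmetrically so that it also makes sense for `k = 0`). -/
def Consecutive {d k : ℕ} (I : Fin k → Fin d) : Prop :=
  ∀ p q : Fin k, (I p : ℕ) + (q : ℕ) = (I q : ℕ) + (p : ℕ)

/-- The row indices `(0, 1, …, k-1)` of the top-right corner `k × k` minor. -/
def cornerI {d : ℕ} (k : ℕ) (hk : k ≤ d) : Fin k → Fin d :=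
  fun p => ⟨(p : ℕ), lt_of_lt_of_le p.isLt hk⟩

/-- The column indices `(d-k, d-k+1, …, d-1)` of the top-right corner `k × k`
minor. -/
def cornerJ {d : ℕ} (k : ℕ) (hk : k ≤ d) : Fin k → Fin d :=
  fun p => ⟨d - k + (p : ℕ), by have h := p.isLt; omega⟩

theorem det_eq_sum_cramer_mul_cramer {R m n : Type*} [CommRing R] [Fintype m] [DecidableEq m]
    [Fintype n] [DecidableEq n] (A : Matrix m m R) (B : Matrix n n R) (r : n → m)
    (c : m → R) (t : n) :
    A.det * B.cramer (fun i => c (r i)) t =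
      ∑ p, A.cramer c p * B.cramer (fun i => A (r i) p) t := by
  have h : A.det • (fun i => c (r i)) = ∑ p, A.cramer c p • fun i => A (r i) p := by
    ext i
    have := congrFun (Matrix.mulVec_cramer A c) (r i)
    simp only [Matrix.mulVec, dotProduct, Pi.smul_apply, smul_eq_mul] at this
    simp [← this, Finset.sum_apply, mul_comm]
  have h2 := congrFun (congrArg B.cramer h) t
  simpa [map_sum, Finset.sum_apply] using h2

/-- The three-term Plücker relation that exchanges the adjacent columns `t`, `t + 1` of a square
matrix with an extra column `c`, the other factors being minors without the last row. -/
theorem det_mul_cramer_submatrix {R : Type*} [CommRing R] {n : ℕ}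
    (A : Matrix (Fin (n + 1)) (Fin (n + 1)) R) (c : Fin (n + 1) → R) (t : Fin n) :
    A.det * (A.submatrix Fin.castSucc t.succ.succAbove).cramer (fun i => c i.castSucc) t =
      (A.updateCol t.castSucc c).det * (A.submatrix Fin.castSucc t.succ.succAbove).det +
      (A.updateCol t.succ c).det * (A.submatrix Fin.castSucc t.castSucc.succAbove).det := by
  rw [det_eq_sum_cramer_mul_cramer A _ Fin.castSucc, Fin.sum_univ_succAbove _ t.succ, add_comm,
    Fintype.sum_eq_single t]
  · congr 1
    · rw [Fin.succAbove_succ_self, Matrix.cramer_apply,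
        Matrix.cramer_row_self _ _ t (by simp)]
      simp
    · rw [Matrix.cramer_apply, Matrix.cramer_apply]
      congr 2
      ext i j
      rcases eq_or_ne j t with rfl | hj
      · simp
      · rw [Matrix.updateCol_ne hj]
        rcases lt_or_gt_of_ne hj with h | h
        · simp [Fin.succAbove_of_castSucc_lt, Fin.lt_def, Fin.lt_def.1 h,
            Nat.lt_succ_of_lt (Fin.lt_def.1 h)]
        · rw [Matrix.submatrix_apply, Matrix.submatrix_apply, Fin.succAbove_of_le_castSucc,
            Fin.succAbove_of_le_castSucc]
          · exact Fin.castSucc_le_castSucc_iff.2 h.le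
          · exact h
  · intro q hq
    rw [Matrix.cramer_row_self (A.submatrix Fin.castSucc t.succ.succAbove) _ q (by simp)]
    simp [hq.symm]

/-- A minor of an upper triangular matrix that is not non-trivial vanishes. -/
theorem det_submatrix_eq_zero_of_lt {R : Type*} [CommRing R] {d k : ℕ}
    {u : Matrix (Fin d) (Fin d) R} (hu : ∀ i j, j < i → u i j = 0) {I J : Fin k → Fin d}
    (hI : StrictMono I) (hJ : StrictMono J) {p : Fin k} (hp : J p < I p) :
    (u.submatrix I J).det = 0 := by
  rw [Matrix.det_apply]
  refine Finset.sum_eq_zero fun σ _ => ?_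
  obtain ⟨i, hi⟩ : ∃ i, J i < I (σ i) := by
    by_contra! h
    have hmaps : ∀ i ∈ Finset.Iic p, σ i ∈ Finset.Iio p := fun i hi =>
      Finset.mem_Iio.2 (hI.lt_iff_lt.1
        (((h i).trans (hJ.monotone (Finset.mem_Iic.1 hi))).trans_lt hp))
    have := Finset.card_le_card_of_injOn σ hmaps σ.injective.injOn
    simp at this
  rw [Finset.prod_eq_zero (Finset.mem_univ i) (hu _ _ hi), smul_zero]

theorem TotallyNonneg.det_submatrix_nonneg {d k : ℕ} {u : Matrix (Fin d) (Fin d) ℝ}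
    (hnn : TotallyNonneg u) (hu : UTUnipotent u) (hk1 : 1 ≤ k) (hk2 : k ≤ d)
    {I J : Fin k → Fin d} (hI : StrictMono I) (hJ : StrictMono J) :
    0 ≤ (u.submatrix I J).det := by
  by_cases h : ∀ p, I p ≤ J p
  · exact hnn k hk1 hk2 I J hI hJ h
  · push Not at h
    obtain ⟨p, hp⟩ := h
    exact (det_submatrix_eq_zero_of_lt hu.1 hI hJ hp).ge

theorem consecutive_of_succ {d n : ℕ} {J : Fin (n + 1) → Fin d}
    (h : ∀ t : Fin n, (J t.succ : ℕ) = J t.castSucc + 1) : Consecutive J := by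
  have key : ∀ p, (J p : ℕ) = J 0 + p := by
    intro p
    induction p using Fin.induction with
    | zero => simp
    | succ t ih => rw [h, ih]; simp [add_assoc]
  intro p q
  rw [key p, key q]
  omega

theorem strictMono_update_castSucc {α : Type*} [Preorder α] {n : ℕ} {J : Fin (n + 1) → α}
    (hJ : StrictMono J) (t : Fin n) {m : α} (h1 : J t.castSucc < m) (h2 : m < J t.succ) :
    StrictMono (Function.update J t.castSucc m) := by
  intro p q hpq
  rcases eq_or_ne p t.castSucc with rfl | hp
  · rw [Function.update_self, Function.update_of_ne hpq.ne']
    exact h2.trans_le (hJ.monotone (Fin.castSucc_lt_iff_succ_le.1 hpq))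
  · rw [Function.update_of_ne hp]
    rcases eq_or_ne q t.castSucc with rfl | hq
    · rw [Function.update_self]
      exact (hJ hpq).trans h1
    · rw [Function.update_of_ne hq]
      exact hJ hpq

theorem strictMono_update_succ {α : Type*} [Preorder α] {n : ℕ} {J : Fin (n + 1) → α}
    (hJ : StrictMono J) (t : Fin n) {m : α} (h1 : J t.castSucc < m) (h2 : m < J t.succ) :
    StrictMono (Function.update J t.succ m) := by
  intro p q hpq
  rcases eq_or_ne q t.succ with rfl | hq
  · rw [Function.update_self, Function.update_of_ne hpq.ne]
    exact (hJ.monotone (Fin.le_castSucc_iff.2 hpq)).trans_lt h1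
  · rw [Function.update_of_ne hq]
    rcases eq_or_ne p t.succ with rfl | hp
    · rw [Function.update_self]
      exact h2.trans (hJ hpq)
    · rw [Function.update_of_ne hp]
      exact hJ hpq

theorem castSucc_le_succAbove {n : ℕ} (s : Fin (n + 1)) (p : Fin n) :
    p.castSucc ≤ s.succAbove p := by
  rw [Fin.succAbove]
  split_ifs
  · exact le_rfl
  · exact Fin.castSucc_lt_succ.le

theorem submatrix_update_eq_updateCol {R l m n o : Type*} [DecidableEq o] (u : Matrix m n R)
    (I : l → m) (J : o → n) (t : o) (c : n) :
    u.submatrix I (Function.update J t c) =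
      (u.submatrix I J).updateCol t fun i => u (I i) c := by
  ext i j
  rcases eq_or_ne j t with rfl | hj
  · simp
  · simp [hj]

/-- Claim (1) in the proof of Lemma A.1. Let `u` be a totally
nonnegative upper triangular unipotent matrix, `1 ≤ k ≤ d`, and suppose every
non-trivial `ℓ × ℓ` minor of `u` with `ℓ < k` is positive. Fix a strictly
increasing tuple `I : Fin k → Fin d`. If every non-trivial `k × k` minor of the
form `det (u.submatrix I J)` with `J` consecutive is positive, then every
non-trivial `k × k` minor of the form `det (u.submatrix I J)` is positive. -/
theorem minors_pos_of_consecutive_column_minors_pos {d : ℕ}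
    (u : Matrix (Fin d) (Fin d) ℝ) (hu : UTUnipotent u) (hnn : TotallyNonneg u)
    (k : ℕ) (hk1 : 1 ≤ k) (hk2 : k ≤ d)
    (hsmall : ∀ ℓ : ℕ, ℓ < k → ∀ I J : Fin ℓ → Fin d,
      StrictMono I → StrictMono J → (∀ p, I p ≤ J p) →
      0 < (u.submatrix I J).det)
    (I : Fin k → Fin d) (hI : StrictMono I)
    (hcons : ∀ J : Fin k → Fin d, Consecutive J →
      (∀ p, I p ≤ J p) → 0 < (u.submatrix I J).det) :
    ∀ J : Fin k → Fin d, StrictMono J →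
      (∀ p, I p ≤ J p) → 0 < (u.submatrix I J).det := by
  obtain ⟨n, rfl⟩ : ∃ n, k = n + 1 := ⟨k - 1, by omega⟩
  intro J
  induction J using WellFoundedGT.induction with
  | ind J ih =>
  intro hJ hIJ
  by_cases hgap : ∀ t : Fin n, (J t.succ : ℕ) = J t.castSucc + 1
  · exact hcons J (consecutive_of_succ hgap) hIJ
  push Not at hgap
  obtain ⟨t, ht⟩ := hgap
  have hlt : J t.castSucc < J t.succ := hJ Fin.castSucc_lt_succ
  obtain ⟨m, hm1, hm2⟩ : ∃ m, J t.castSucc < m ∧ m < J t.succ :=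
    ⟨⟨J t.castSucc + 1, by omega⟩, by simp [Fin.lt_def], by rw [Fin.lt_def] at hlt ⊢; dsimp only; omega⟩
  have hJ1 : J < Function.update J t.castSucc m := lt_update_self_iff.2 hm1
  have hpos := ih _ hJ1 (strictMono_update_castSucc hJ t hm1 hm2)
    fun p => (hIJ p).trans (hJ1.le p)
  have hnonneg := hnn.det_submatrix_nonneg hu hk1 hk2 hI (strictMono_update_succ hJ t hm1 hm2)
  have hminor (s : Fin (n + 1)) :
      0 < (u.submatrix (I ∘ Fin.castSucc) (J ∘ s.succAbove)).det :=
    hsmall n n.lt_succ_self _ _ (hI.comp Fin.strictMono_castSucc)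
      (hJ.comp (Fin.strictMono_succAbove s))
      fun p => (hIJ _).trans (hJ.monotone (castSucc_le_succAbove s p))
  have hrel := det_mul_cramer_submatrix (u.submatrix I J) (fun i => u (I i) m) t
  rw [← submatrix_update_eq_updateCol, ← submatrix_update_eq_updateCol,
    Matrix.submatrix_submatrix, Matrix.submatrix_submatrix] at hrel
  refine (hnn _ hk1 hk2 I J hI hJ hIJ).lt_of_ne fun h0 => ?_
  rw [← h0, zero_mul] at hrel
  exact (add_pos_of_pos_of_nonneg (mul_pos hpos (hminor t.succ))
    (mul_nonneg hnonneg (hminor t.castSucc).le)).ne hrel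
end

section
/- Let u be a d×d real totally nonnegative upper triangular unipotent matrix. Then u is totally positive if and only if for every k with 1 ≤ k ≤ d−1 the top-right corner k×k minor of u is positive, i.e. det(u.submatrix I₀ J₀) > 0 where I₀ = (0, 1, …, k−1) and J₀ = (d−k, d−k+1, …, d−1) (0-indexed). -/
open Matrix

/-- Laplace expansion along a column placed at position `p`: up to the sign `(-1) ^ p` the
determinant does not depend on where the column is inserted. -/
lemma det_submatrix_insertNth {m : Type*} {n : ℕ} (B : Matrix (Fin (n + 1)) m ℝ)
    (p : Fin (n + 1)) (x : m) (g : Fin n → m) :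
    (B.submatrix id (Fin.insertNth (α := fun _ => m) p x g)).det =
      (-1) ^ (p : ℕ) * ∑ i : Fin (n + 1),
        (-1) ^ (i : ℕ) * B i x * (B.submatrix i.succAbove g).det := by
  rw [Matrix.det_succ_column _ p, Finset.mul_sum]
  refine Finset.sum_congr rfl fun i _ => ?_
  have h : (B.submatrix id (Fin.insertNth (α := fun _ => m) p x g)).submatrix
      i.succAbove p.succAbove = B.submatrix i.succAbove g := by
    ext a b
    simp
  rw [h]
  simp only [Matrix.submatrix_apply, Fin.insertNth_apply_same, id]
  ring

lemma strictMono_insertNth {α : Type*} [Preorder α] {n : ℕ} (p : Fin (n + 1)) (x : α)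
    (g : Fin n → α) (hg : StrictMono g) (hlt : ∀ i : Fin n, i.castSucc < p → g i < x)
    (hgt : ∀ i : Fin n, p ≤ i.castSucc → x < g i) :
    StrictMono (Fin.insertNth (α := fun _ => α) p x g) := by
  intro a b hab
  rcases Fin.eq_self_or_eq_succAbove p a with ha | ⟨a, rfl⟩ <;>
    rcases Fin.eq_self_or_eq_succAbove p b with hb | ⟨b, rfl⟩
  · exact absurd (ha.trans hb.symm) hab.ne
  · subst ha
    simpa using hgt b ((Fin.lt_succAbove_iff_le_castSucc _ _).1 hab)
  · subst hb
    simpa using hlt a ((Fin.succAbove_lt_iff_castSucc_lt _ _).1 hab)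
  · simpa using hg (Fin.succAbove_lt_succAbove_iff.1 hab)

/-- The minors of an upper triangular matrix that are not non-trivial vanish. -/
lemma UTUnipotent.det_submatrix_eq_zero {d k : ℕ} {u : Matrix (Fin d) (Fin d) ℝ}
    (hu : UTUnipotent u) {I J : Fin k → Fin d} (hI : StrictMono I) (hJ : StrictMono J)
    {p : Fin k} (hp : J p < I p) : (u.submatrix I J).det = 0 := by
  rw [Matrix.det_apply]
  refine Finset.sum_eq_zero fun σ _ => ?_
  obtain ⟨b, hb, hσ⟩ : ∃ b ≤ p, p ≤ σ b := by
    by_contra! h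
    have hcard : (Finset.Iic p).card ≤ (Finset.Iio p).card :=
      Finset.card_le_card_of_injOn σ (fun b hb => by
        simpa using h b (by simpa using hb)) σ.injective.injOn
    simp at hcard
  rw [Finset.prod_eq_zero (Finset.mem_univ b), smul_zero]
  exact hu.1 _ _ ((hJ.monotone hb).trans_lt (hp.trans_le (hI.monotone hσ)))

lemma TotallyNonneg.det_nonneg {d k : ℕ} {u : Matrix (Fin d) (Fin d) ℝ}
    (hnn : TotallyNonneg u) (hu : UTUnipotent u) {I J : Fin k → Fin d}
    (hI : StrictMono I) (hJ : StrictMono J) : 0 ≤ (u.submatrix I J).det := by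
  by_cases h : ∀ p, I p ≤ J p
  · rcases Nat.eq_zero_or_pos k with rfl | hk
    · simp
    · exact hnn k hk (by simpa using Fintype.card_le_of_injective I hI.injective) I J hI hJ h
  · push Not at h
    obtain ⟨p, hp⟩ := h
    exact (hu.det_submatrix_eq_zero hI hJ hp).ge

/-- Lowering a column index other than the last one preserves positivity of a minor, provided
that the resulting minor without its last row and column is positive. -/
lemma TotallyNonneg.det_pos_update_castSucc {d n : ℕ} {u : Matrix (Fin d) (Fin d) ℝ}
    (hnn : TotallyNonneg u) (hu : UTUnipotent u) {I J : Fin (n + 2) → Fin d}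
    (hI : StrictMono I) (hJ : StrictMono J) (p : Fin (n + 1)) (x : Fin d)
    (hx : x < J p.castSucc) (hJ' : StrictMono (Function.update J p.castSucc x))
    (hpos : 0 < (u.submatrix I J).det)
    (hinit : 0 < (u.submatrix (I ∘ Fin.castSucc)
      (Function.update J p.castSucc x ∘ Fin.castSucc)).det) :
    0 < (u.submatrix I (Function.update J p.castSucc x)).det := by
  set A := u.submatrix I J with hA
  set v : Fin (n + 2) → ℝ := fun i => u (I i) x with hv
  set L := u.submatrix (I ∘ Fin.castSucc) (J ∘ Fin.castSucc) with hL
  have hIc : StrictMono (I ∘ Fin.castSucc) := hI.comp Fin.strictMono_castSucc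
  have hJc : StrictMono (J ∘ Fin.castSucc) := hJ.comp Fin.strictMono_castSucc
  have hcr : ∀ i : Fin (n + 2), ∑ m, A i m * Matrix.cramer A v m = A.det * v i := by
    intro i
    have := congrFun (Matrix.mulVec_cramer A v) i
    simpa [Matrix.mulVec, dotProduct] using this
  have hcol : ∀ w : Fin (n + 1) → ℝ, (L.updateCol p w).det =
      ∑ i, w i * L.adjugate p i := by
    intro w
    rw [← Matrix.cramer_apply, Matrix.cramer_eq_adjugate_mulVec]
    simp [Matrix.mulVec, dotProduct, mul_comm]
  have hother : ∀ m : Fin (n + 1), m ≠ p →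
      (L.updateCol p (fun i => A i.castSucc m.castSucc)).det = 0 := by
    intro m hm
    refine Matrix.det_zero_of_column_eq hm fun i => ?_
    simp [hm, hL, hA]
  have hself : (L.updateCol p (fun i => A i.castSucc p.castSucc)).det = L.det := by
    congr 1
    exact Matrix.updateCol_eq_self L p
  have hrel : A.det * (L.updateCol p (fun i => v i.castSucc)).det =
      Matrix.cramer A v p.castSucc * L.det + Matrix.cramer A v (Fin.last _) *
        (L.updateCol p (fun i => A i.castSucc (Fin.last _))).det := by
    have h1 : A.det * (L.updateCol p (fun i => v i.castSucc)).det =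
        ∑ m, Matrix.cramer A v m * (L.updateCol p (fun i => A i.castSucc m)).det := by
      simp only [hcol, Finset.mul_sum]
      rw [Finset.sum_comm]
      refine Finset.sum_congr rfl fun i _ => ?_
      rw [← mul_assoc, ← hcr, Finset.sum_mul]
      exact Finset.sum_congr rfl fun m _ => by ring
    rw [h1, Fin.sum_univ_castSucc, Finset.sum_eq_single p, hself]
    · intro m _ hm
      rw [hother m hm, mul_zero]
    · simp
  have hupd : L.updateCol p (fun i => v i.castSucc) = u.submatrix (I ∘ Fin.castSucc)
      (Function.update J p.castSucc x ∘ Fin.castSucc) := by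
    ext i j
    by_cases h : j = p <;> simp [h, hL, hv]
  have hgoal : Matrix.cramer A v p.castSucc =
      (u.submatrix I (Function.update J p.castSucc x)).det := by
    rw [Matrix.cramer_apply]
    congr 1
    ext i j
    by_cases h : j = p.castSucc <;> simp [h, hA, hv]
  have hlast : Matrix.cramer A v (Fin.last _) = ((u.submatrix I id).submatrix id
      (Fin.insertNth (α := fun _ => Fin d) (Fin.last _) x (J ∘ Fin.castSucc))).det := by
    rw [Matrix.cramer_apply]
    congr 1
    ext i j
    refine Fin.lastCases ?_ (fun j => ?_) j <;>
      simp [hA, hv]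
  have hlast' : L.updateCol p (fun i => A i.castSucc (Fin.last _)) =
      (u.submatrix (I ∘ Fin.castSucc) id).submatrix id
        (Fin.insertNth (α := fun _ => Fin d) p (J (Fin.last _))
          (J ∘ Fin.castSucc ∘ p.succAbove)) := by
    ext i j
    rcases Fin.eq_self_or_eq_succAbove p j with rfl | ⟨j, rfl⟩ <;>
      simp [hA, hL]
  have hn1 : 0 ≤ ((u.submatrix I id).submatrix id
      (Fin.insertNth (α := fun _ => Fin d) p.castSucc x (J ∘ Fin.castSucc))).det := by
    refine hnn.det_nonneg hu hI (strictMono_insertNth _ _ _ hJc (fun i hi => ?_) fun i hi => ?_)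
    · have := hJ' hi
      simpa [Function.update_of_ne hi.ne] using this
    · exact hx.trans_le (hJ.monotone hi)
  have hn2 : 0 ≤ ((u.submatrix (I ∘ Fin.castSucc) id).submatrix id
        (Fin.insertNth (α := fun _ => Fin d) (Fin.last n) (J (Fin.last _))
          (J ∘ Fin.castSucc ∘ p.succAbove))).det := by
    refine hnn.det_nonneg hu hIc (strictMono_insertNth _ _ _
      (hJc.comp (Fin.strictMono_succAbove p)) (fun i hi => ?_) fun i hi => ?_)
    · exact hJ (Fin.castSucc_lt_last _)
    · exact absurd hi (not_le.2 (Fin.castSucc_lt_last _))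
  rw [hupd, hgoal, hlast, hlast'] at hrel
  rw [det_submatrix_insertNth] at hn1 hn2
  rw [det_submatrix_insertNth _ (Fin.last _), det_submatrix_insertNth _ p] at hrel
  simp only [Fin.val_castSucc, Fin.val_last] at hn1 hn2 hrel
  have hmul := mul_nonneg hn1 hn2
  have hLnn : 0 ≤ L.det := hnn.det_nonneg hu hIc hJc
  have h0 := mul_pos hpos hinit
  refine pos_of_mul_pos_left (b := L.det) ?_ hLnn
  rw [pow_succ] at hrel
  nlinarith [hmul, h0, hrel]

/-- Lowering the last column index preserves positivity of a minor, as long as the minor stays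
non-trivial. -/
lemma TotallyNonneg.det_pos_update_last {d n : ℕ} {u : Matrix (Fin d) (Fin d) ℝ}
    (hnn : TotallyNonneg u) (hu : UTUnipotent u) {I J : Fin (n + 1) → Fin d}
    (hI : StrictMono I) (x : Fin d)
    (hx : x < J (Fin.last n)) (hIx : I (Fin.last n) ≤ x)
    (hJ' : StrictMono (Function.update J (Fin.last n) x))
    (hpos : 0 < (u.submatrix I J).det) :
    0 < (u.submatrix I (Function.update J (Fin.last n) x)).det := by
  set J' := Function.update J (Fin.last n) x with hJ'def
  have hJ'last : J' (Fin.last n) = x := by simp [hJ'def]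
  have hJ'cs : ∀ i : Fin n, J' i.castSucc = J i.castSucc := by simp [hJ'def]
  have hzero : ∀ i : Fin n, u x (J' i.castSucc) = 0 := fun i =>
    hu.1 _ _ (by
      have := hJ' (Fin.castSucc_lt_last i)
      rwa [hJ'last] at this)
  suffices h : (u.submatrix I J).det ≤ u x (J (Fin.last n)) * (u.submatrix I J').det by
    exact pos_of_mul_pos_right (hpos.trans_le h) (by
      simpa using hnn.det_nonneg hu (I := fun _ : Fin 1 => x) (J := fun _ => J (Fin.last n))
        (Subsingleton.strictMono _) (Subsingleton.strictMono _))
  rcases hIx.eq_or_lt with hIx | hIx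
  · rw [Matrix.det_succ_row _ (Fin.last n), Matrix.det_succ_row (u.submatrix I J') (Fin.last n),
      Fin.sum_univ_castSucc, Fin.sum_univ_castSucc, Finset.sum_eq_zero, Finset.sum_eq_zero]
    · have : (u.submatrix I J').submatrix (Fin.last n).succAbove (Fin.last n).succAbove =
          (u.submatrix I J).submatrix (Fin.last n).succAbove (Fin.last n).succAbove := by
        ext a b
        simp [hJ'cs]
      rw [this]
      simp only [Matrix.submatrix_apply, hIx, hJ'last, hu.2]
      apply le_of_eq
      ring
    · intro i _
      simp [hIx, hzero]
    · intro i _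
      simp [hIx, ← hJ'cs, hzero]
  · have hR : StrictMono (Fin.insertNth (α := fun _ => Fin d) (Fin.last (n + 1)) x I) :=
      strictMono_insertNth _ _ _ hI
        (fun i _ => (hI.monotone (Fin.le_last i)).trans_lt hIx)
        fun i hi => absurd hi (not_le.2 (Fin.castSucc_lt_last _))
    have hC : StrictMono (Fin.insertNth (α := fun _ => Fin d) (Fin.last (n + 1))
        (J (Fin.last n)) J') :=
      strictMono_insertNth _ _ _ hJ'
        (fun i _ => ((hJ'.monotone (Fin.le_last i)).trans_eq hJ'last).trans_lt hx)
        fun i hi => absurd hi (not_le.2 (Fin.castSucc_lt_last _))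
    have h := hnn.det_nonneg hu hR hC
    rw [Matrix.det_succ_row _ (Fin.last (n + 1)), Fin.sum_univ_castSucc,
      Fin.sum_univ_castSucc, Finset.sum_eq_zero] at h
    · have h1 : (u.submatrix (Fin.insertNth (α := fun _ => Fin d) (Fin.last (n + 1)) x I)
          (Fin.insertNth (α := fun _ => Fin d) (Fin.last (n + 1)) (J (Fin.last n)) J')).submatrix
          (Fin.last (n + 1)).succAbove (Fin.last (n + 1)).succAbove = u.submatrix I J' := by
        ext a b
        simp
      have h2 : (u.submatrix (Fin.insertNth (α := fun _ => Fin d) (Fin.last (n + 1)) x I)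
          (Fin.insertNth (α := fun _ => Fin d) (Fin.last (n + 1)) (J (Fin.last n)) J')).submatrix
          (Fin.last (n + 1)).succAbove (Fin.last n).castSucc.succAbove = u.submatrix I J := by
        ext a b
        refine Fin.lastCases ?_ (fun b => ?_) b
        · simp
        · have hb : (Fin.last n).castSucc.succAbove b.castSucc = b.castSucc.castSucc :=
            Fin.succAbove_of_castSucc_lt _ _ (by simp [Fin.lt_def])
          simp [hb, hJ'cs]
      rw [h1, h2] at h
      have hsign : (-1 : ℝ) ^ (n + 1 + n) = -1 := Odd.neg_one_pow ⟨n, by ring⟩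
      have hsign' : (-1 : ℝ) ^ (n + 1 + (n + 1)) = 1 := Even.neg_one_pow ⟨n + 1, rfl⟩
      simp only [Matrix.submatrix_apply, Fin.insertNth_last', Fin.snoc_last, Fin.snoc_castSucc,
        Fin.val_last, Fin.val_castSucc, hJ'last, hu.2, hsign, hsign'] at h
      linarith
    · intro i _
      simp [hzero]

lemma strictMono_cornerJ {d k : ℕ} (hk : k ≤ d) : StrictMono (cornerJ k hk) := by
  intro a b hab
  simp only [cornerJ, Fin.lt_def] at hab ⊢
  omega

lemma le_cornerJ {d k : ℕ} (hk : k ≤ d) {J : Fin k → Fin d} (hJ : StrictMono J) (p : Fin k) :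
    J p ≤ cornerJ k hk p := by
  have h : ∀ m : ℕ, ∀ q : Fin k, (q : ℕ) + m + 1 = k → (J q : ℕ) + m + 1 ≤ d := by
    intro m
    induction m with
    | zero => intro q _; have := (J q).isLt; omega
    | succ m ih =>
      intro q hq
      have h1 := ih ⟨q + 1, by omega⟩ (by simp only; omega)
      have h2 : J q < J ⟨q + 1, by omega⟩ := hJ (by simp [Fin.lt_def])
      rw [Fin.lt_def] at h2
      omega
  have := h (k - 1 - p) p (by have := p.isLt; omega)
  have := p.isLt
  simp only [cornerJ, Fin.le_def]
  omega

/-- If the minors with row indices in a family closed under deleting the last index and with the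
last columns are positive, so are all non-trivial minors with row indices in that family. -/
lemma TotallyNonneg.det_pos_of_cornerJ {d : ℕ} {u : Matrix (Fin d) (Fin d) ℝ}
    (hnn : TotallyNonneg u) (hu : UTUnipotent u) (S : ∀ k, (Fin k → Fin d) → Prop)
    (hS : ∀ k (I : Fin (k + 1) → Fin d), S (k + 1) I → S k (I ∘ Fin.castSucc))
    (hcorner : ∀ k (hk : k ≤ d) (I : Fin k → Fin d), StrictMono I → S k I →
      0 < (u.submatrix I (cornerJ k hk)).det) (k : ℕ) :
    ∀ I J : Fin k → Fin d, S k I → StrictMono I → StrictMono J → (∀ p, I p ≤ J p) →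
      0 < (u.submatrix I J).det := by
  induction k with
  | zero => intro I J _ _ _ _; simp
  | succ k ih =>
    intro I T hSI hI hT hIT
    have hk : k + 1 ≤ d := by simpa using Fintype.card_le_of_injective I hI.injective
    set M := cornerJ (k + 1) hk with hM
    have hMT : ∀ p, T p ≤ M p := le_cornerJ hk hT
    have hMmono : StrictMono M := strictMono_cornerJ hk
    let H : ℕ → Fin (k + 1) → Fin d := fun m p => if (p : ℕ) < m then T p else M p
    have hHmono : ∀ m, StrictMono (H m) := by
      intro m a b hab
      have hab' : (a : ℕ) < b := hab
      simp only [H]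
      split_ifs with ha hb hb
      · exact hT hab
      · exact (hT hab).trans_le (hMT b)
      · omega
      · exact hMmono hab
    have hIH : ∀ m p, I p ≤ H m p := by
      intro m p
      simp only [H]
      split_ifs
      · exact hIT p
      · exact (hIT p).trans (hMT p)
    have hHsucc : ∀ p : Fin (k + 1), H (p + 1) = Function.update (H p) p (T p) := by
      intro p
      ext q
      rcases eq_or_ne q p with rfl | hq
      · simp [H]
      · have : (q : ℕ) ≠ p := fun h => hq (Fin.ext h)
        have hiff : (q : ℕ) < p + 1 ↔ (q : ℕ) < p := by omega
        simp [H, Function.update_of_ne hq, hiff]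
    have hall : ∀ m, m ≤ k + 1 → 0 < (u.submatrix I (H m)).det := by
      intro m
      induction m with
      | zero =>
        intro _
        have : H 0 = M := by ext q; simp [H]
        rw [this]
        exact hcorner _ hk I hI hSI
      | succ m ihm =>
        intro hm
        obtain ⟨p, rfl⟩ : ∃ p : Fin (k + 1), (p : ℕ) = m := ⟨⟨m, by omega⟩, rfl⟩
        have hprev := ihm (by omega)
        have hmono := hHmono (p + 1)
        have hle := hIH (p + 1)
        have hHp : H p p = M p := by simp [H]
        rcases (hMT p).eq_or_lt with heq | hlt
        · rwa [hHsucc, heq, ← hHp, Function.update_eq_self]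
        · rw [hHsucc] at hmono hle ⊢
          rw [← hHp] at hlt
          refine Fin.lastCases (motive := fun p => T p < H p p →
            StrictMono (Function.update (H p) p (T p)) →
            (∀ q, I q ≤ Function.update (H p) p (T p) q) →
            0 < (u.submatrix I (H p)).det →
            0 < (u.submatrix I (Function.update (H p) p (T p))).det)
            ?_ (fun p => ?_) p hlt hmono hle hprev
          · intro hlt hmono _ hprev
            exact hnn.det_pos_update_last hu hI _ hlt (hIT _) hmono hprev
          · intro hlt hmono hle hprev
            obtain ⟨n, rfl⟩ : ∃ n, k = n + 1 := ⟨k - 1, by have := p.isLt; omega⟩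
            exact hnn.det_pos_update_castSucc hu hI (hHmono _) p _ hlt hmono hprev
              (ih _ _ (hS _ _ hSI) (hI.comp Fin.strictMono_castSucc)
                (hmono.comp Fin.strictMono_castSucc) fun q => hle _)
    have hfin := hall (k + 1) le_rfl
    have : H (k + 1) = T := by ext q; simp [H, q.isLt]
    rwa [this] at hfin

/-- The reflection of a matrix in its antidiagonal. -/
def antiTranspose {d : ℕ} (u : Matrix (Fin d) (Fin d) ℝ) : Matrix (Fin d) (Fin d) ℝ :=
  u.transpose.submatrix Fin.rev Fin.rev

lemma det_antiTranspose_submatrix {d k : ℕ} (u : Matrix (Fin d) (Fin d) ℝ)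
    (I J : Fin k → Fin d) : ((antiTranspose u).submatrix I J).det =
      (u.submatrix (Fin.rev ∘ J ∘ Fin.rev) (Fin.rev ∘ I ∘ Fin.rev)).det := by
  rw [← Matrix.det_transpose, ← Matrix.det_submatrix_equiv_self Fin.revPerm]
  rfl

lemma strictMono_rev_comp_rev {d k : ℕ} {I : Fin k → Fin d} (hI : StrictMono I) :
    StrictMono (Fin.rev ∘ I ∘ Fin.rev) :=
  fun _ _ hab => Fin.rev_lt_rev.2 (hI (Fin.rev_lt_rev.2 hab))

lemma UTUnipotent.antiTranspose {d : ℕ} {u : Matrix (Fin d) (Fin d) ℝ} (hu : UTUnipotent u) :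
    UTUnipotent (antiTranspose u) :=
  ⟨fun _ _ hij => hu.1 _ _ (Fin.rev_lt_rev.2 hij), fun i => hu.2 i.rev⟩

lemma TotallyNonneg.antiTranspose {d : ℕ} {u : Matrix (Fin d) (Fin d) ℝ}
    (hnn : TotallyNonneg u) : TotallyNonneg (antiTranspose u) := by
  intro k hk hkd I J hI hJ hIJ
  rw [det_antiTranspose_submatrix]
  exact hnn k hk hkd _ _ (strictMono_rev_comp_rev hJ) (strictMono_rev_comp_rev hI)
    fun p => Fin.rev_le_rev.2 (hIJ _)

lemma rev_comp_cornerI_comp_rev {d k : ℕ} (hk : k ≤ d) :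
    Fin.rev ∘ cornerI k hk ∘ Fin.rev = cornerJ k hk := by
  ext p
  have := p.isLt
  simp only [cornerI, cornerJ, Function.comp, Fin.val_rev]
  omega

lemma rev_comp_cornerJ_comp_rev {d k : ℕ} (hk : k ≤ d) :
    Fin.rev ∘ cornerJ k hk ∘ Fin.rev = cornerI k hk := by
  ext p
  have := p.isLt
  simp only [cornerI, cornerJ, Function.comp, Fin.val_rev]
  omega

lemma UTUnipotent.det_eq_one {d : ℕ} {u : Matrix (Fin d) (Fin d) ℝ} (hu : UTUnipotent u) :
    u.det = 1 := by
  rw [Matrix.det_of_isUpperTriangular fun i j hij => hu.1 i j hij]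
  simp [hu.2]

/-- A totally nonnegative upper triangular unipotent matrix
is totally positive if and only if all its top-right corner `k × k` minors,
`1 ≤ k ≤ d - 1`, are positive. -/
theorem totallyPositive_iff_corner_minors_pos {d : ℕ}
    (u : Matrix (Fin d) (Fin d) ℝ) (hu : UTUnipotent u) (hnn : TotallyNonneg u) :
    TotallyPositive u ↔
      ∀ (k : ℕ) (_ : 1 ≤ k) (h2 : k ≤ d - 1),
        0 < (u.submatrix (cornerI k (by omega)) (cornerJ k (by omega))).det := by
  constructor
  · intro h k hk hkd
    refine h k hk (by omega) _ _ (fun a b hab => hab) (strictMono_cornerJ _) fun p => ?_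
    simp only [cornerI, cornerJ, Fin.le_def]
    omega
  · intro h
    have hc : ∀ k (hk : k ≤ d), 0 < (u.submatrix (cornerI k hk) (cornerJ k hk)).det := by
      intro k hk
      rcases Nat.eq_zero_or_pos k with rfl | hk0
      · simp
      rcases hk.eq_or_lt with rfl | hlt
      · have hI : cornerI k hk = id := rfl
        have hJ : cornerJ k hk = id := by
          ext p
          simp [cornerJ]
        rw [hI, hJ, Matrix.submatrix_id_id, hu.det_eq_one]
        exact one_pos
      · exact h k hk0 (by omega)
    have hrows : ∀ k (hk : k ≤ d) (I : Fin k → Fin d), StrictMono I →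
        0 < (u.submatrix I (cornerJ k hk)).det := by
      intro k hk I hI
      have hpos := hnn.antiTranspose.det_pos_of_cornerJ hu.antiTranspose
        (fun _ I => ∀ p, (I p : ℕ) = p) (fun _ _ hI p => hI p.castSucc)
        (fun k hk I _ hSI => by
          obtain rfl : I = cornerI k hk := funext fun p => Fin.ext (hSI p)
          rw [det_antiTranspose_submatrix, rev_comp_cornerI_comp_rev,
            rev_comp_cornerJ_comp_rev]
          exact hc k hk)
        k (cornerI k hk) (Fin.rev ∘ I ∘ Fin.rev) (fun _ => rfl) (fun _ _ hab => hab)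
        (strictMono_rev_comp_rev hI) (fun p => by
          have := Fin.rev_le_rev.2 (le_cornerJ hk hI p.rev)
          rwa [← rev_comp_cornerJ_comp_rev])
      rw [det_antiTranspose_submatrix, rev_comp_cornerI_comp_rev] at hpos
      convert hpos using 3
      ext p
      simp
    intro k _ _ I J hI hJ hIJ
    exact hnn.det_pos_of_cornerJ hu (fun _ _ => True) (fun _ _ _ => trivial)
      (fun k hk I hI _ => hrows k hk I hI) k I J trivial hI hJ hIJ
end
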